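/- Let f : ℝ^n → ℝ^n be locally Lipschitz with f(θ*) = 0. Let r : ℝ^n → ℝ³ be continuously differentiable with b := r(θ*) ≠ 0, let α ∈ (0, π/2), and define C(θ) := ‖r(θ) − b‖² ‖b‖² cos²(α) − ⟨r(θ) − b, b⟩² and C⁺ := {θ : C(θ) > 0}. Assume there exists w ∈ ℝ^n with Dr(θ*)w nonzero and orthogonal to b. If there exists ρ > 0 such that ⟨∇C(θ), f(θ)⟩ > 0 for all θ ∈ C⁺ within the closed ball of radius ρ around θ*, then θ* is an unstable equilibrium of θ̇ = f(θ); i.e., θ* is not Lyapunov stable. -/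

import Mathlib

open Metric Set Filter Topology Real RealInnerProductSpace

/-- A solution of `θ̇ = g(θ)` on an interval `I ⊆ ℝ` containing `0`. -/
def IsSolution {n : ℕ} (g : EuclideanSpace ℝ (Fin n) → EuclideanSpace ℝ (Fin n))
    (γ : ℝ → EuclideanSpace ℝ (Fin n)) (I : Set ℝ) : Prop :=
  (0 : ℝ) ∈ I ∧ I.OrdConnected ∧ ∀ t ∈ I, HasDerivWithinAt γ (g (γ t)) I t

/-- Lyapunov stability of `θ₀` for `θ̇ = g(θ)`. -/
def LyapunovStable {n : ℕ} (g : EuclideanSpace ℝ (Fin n) → EuclideanSpace ℝ (Fin n))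
    (θ₀ : EuclideanSpace ℝ (Fin n)) : Prop :=
  ∀ ε > 0, ∃ δ > 0, ∀ (γ : ℝ → EuclideanSpace ℝ (Fin n)) (I : Set ℝ),
    IsSolution g γ I → ‖γ 0 - θ₀‖ < δ → ∀ t ∈ I, 0 ≤ t → ‖γ t - θ₀‖ < ε

lemma aux_local {n : ℕ} (f : EuclideanSpace ℝ (Fin n) → EuclideanSpace ℝ (Fin n))
    (hf : LocallyLipschitz f) (x₀ : EuclideanSpace ℝ (Fin n)) :
    ∃ r > (0 : ℝ), ∃ τ > (0 : ℝ), ∀ y ∈ Metric.closedBall x₀ r, ∀ t₀ : ℝ,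
      ∃ γ : ℝ → EuclideanSpace ℝ (Fin n), γ t₀ = y ∧
        ∀ t ∈ Icc t₀ (t₀ + τ), HasDerivWithinAt γ (f (γ t)) (Icc t₀ (t₀ + τ)) t := by
  obtain ⟨K, s, hs, hl⟩ := hf x₀
  obtain ⟨a, ha, has⟩ := Metric.nhds_basis_closedBall.mem_iff.mp hs
  have hcomp : IsCompact (Metric.closedBall x₀ a) := isCompact_closedBall _ _
  obtain ⟨M, hM⟩ := hcomp.exists_bound_of_continuousOn hf.continuous.continuousOn
  set L : ℝ := max M 0 + 1 with hL
  have hL0 : 0 < L := by positivity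
  have hτ : 0 < a / 2 / L := by positivity
  refine ⟨a / 2, by positivity, a / 2 / L, hτ, fun y hy t₀ => ?_⟩
  have hpl : IsPicardLindelof (fun _ ↦ f) (tmin := t₀) (tmax := t₀ + a / 2 / L)
      ⟨t₀, by simp [hτ.le]⟩ x₀ (.mk a ha.le) (.mk (a / 2) (by positivity)) (.mk L hL0.le) K := by
    refine IsPicardLindelof.of_time_independent (fun x hx => ?_) (hl.mono has) ?_
    · have := hM x hx
      have h2 := le_max_left M 0
      change ‖f x‖ ≤ L
      linarith
    · change L * max (t₀ + a / 2 / L - t₀) (t₀ - t₀) ≤ a - a / 2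
      rw [add_sub_cancel_left, sub_self, max_eq_left hτ.le, mul_div_cancel₀ _ hL0.ne']
      linarith
  exact hpl.exists_eq_forall_mem_Icc_hasDerivWithinAt hy

lemma aux_uniform {n : ℕ} (f : EuclideanSpace ℝ (Fin n) → EuclideanSpace ℝ (Fin n))
    (hf : LocallyLipschitz f) (S : Set (EuclideanSpace ℝ (Fin n))) (hS : IsCompact S) :
    ∃ τ > (0 : ℝ), ∀ y ∈ S, ∀ t₀ : ℝ,
      ∃ γ : ℝ → EuclideanSpace ℝ (Fin n), γ t₀ = y ∧
        ∀ t ∈ Icc t₀ (t₀ + τ), HasDerivWithinAt γ (f (γ t)) (Icc t₀ (t₀ + τ)) t := by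
  have key : ∀ (τ τ' t₀ : ℝ) (γ : ℝ → EuclideanSpace ℝ (Fin n)), τ' ≤ τ →
      (∀ t ∈ Icc t₀ (t₀ + τ), HasDerivWithinAt γ (f (γ t)) (Icc t₀ (t₀ + τ)) t) →
      (∀ t ∈ Icc t₀ (t₀ + τ'), HasDerivWithinAt γ (f (γ t)) (Icc t₀ (t₀ + τ')) t) := by
    intro τ τ' t₀ γ h H t ht
    have hsub : Icc t₀ (t₀ + τ') ⊆ Icc t₀ (t₀ + τ) := Icc_subset_Icc le_rfl (by linarith)
    exact (H t (hsub ht)).mono hsub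
  refine IsCompact.induction_on hS (p := fun S => ∃ τ > (0 : ℝ), ∀ y ∈ S, ∀ t₀ : ℝ,
      ∃ γ : ℝ → EuclideanSpace ℝ (Fin n), γ t₀ = y ∧
        ∀ t ∈ Icc t₀ (t₀ + τ), HasDerivWithinAt γ (f (γ t)) (Icc t₀ (t₀ + τ)) t)
    ⟨1, one_pos, by simp⟩ ?_ ?_ ?_
  · rintro s t hst ⟨τ, hτ, h⟩
    exact ⟨τ, hτ, fun y hy => h y (hst hy)⟩
  · rintro s t ⟨τ, hτ, h⟩ ⟨τ', hτ', h'⟩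
    refine ⟨min τ τ', lt_min hτ hτ', fun y hy t₀ => ?_⟩
    rcases hy with hy | hy
    · obtain ⟨γ, h1, h2⟩ := h y hy t₀
      exact ⟨γ, h1, key _ _ _ _ (min_le_left _ _) h2⟩
    · obtain ⟨γ, h1, h2⟩ := h' y hy t₀
      exact ⟨γ, h1, key _ _ _ _ (min_le_right _ _) h2⟩
  · intro x _
    obtain ⟨r, hr, τ, hτ, h⟩ := aux_local f hf x
    exact ⟨Metric.closedBall x r, mem_nhdsWithin_of_mem_nhds (Metric.closedBall_mem_nhds x hr),
      τ, hτ, h⟩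

lemma aux_glue {n : ℕ} (f : EuclideanSpace ℝ (Fin n) → EuclideanSpace ℝ (Fin n))
    (T τ : ℝ) (hT : 0 ≤ T) (hτ : 0 < τ) (γ η : ℝ → EuclideanSpace ℝ (Fin n))
    (hγ : ∀ t ∈ Icc 0 T, HasDerivWithinAt γ (f (γ t)) (Icc 0 T) t)
    (hη : ∀ t ∈ Icc T (T + τ), HasDerivWithinAt η (f (η t)) (Icc T (T + τ)) t)
    (h : η T = γ T) :
    ∃ ζ : ℝ → EuclideanSpace ℝ (Fin n), ζ 0 = γ 0 ∧
      ∀ t ∈ Icc 0 (T + τ), HasDerivWithinAt ζ (f (ζ t)) (Icc 0 (T + τ)) t := by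
  classical
  let ζ : ℝ → EuclideanSpace ℝ (Fin n) := fun t => if t ≤ T then γ t else η t
  have e1 : ∀ t ∈ Icc 0 T, ζ t = γ t := fun t ht => if_pos ht.2
  have e2 : ∀ t ∈ Icc T (T + τ), ζ t = η t := by
    intro t ht
    rcases eq_or_lt_of_le ht.1 with h' | h'
    · subst h'; simp [ζ, h]
    · simp [ζ, not_le.mpr h']
  have hU : Icc 0 (T + τ) = Icc 0 T ∪ Icc T (T + τ) :=
    (Icc_union_Icc_eq_Icc hT (by linarith)).symm
  refine ⟨ζ, e1 0 ⟨le_rfl, hT⟩, fun t ht => ?_⟩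
  have d1 : HasDerivWithinAt ζ (f (ζ t)) (Icc 0 T) t := by
    by_cases h1 : t ∈ Icc 0 T
    · rw [e1 t h1]
      exact (hγ t h1).congr e1 (e1 t h1)
    · apply HasFDerivWithinAt.of_notMem_closure
      rwa [isClosed_Icc.closure_eq]
  have d2 : HasDerivWithinAt ζ (f (ζ t)) (Icc T (T + τ)) t := by
    by_cases h1 : t ∈ Icc T (T + τ)
    · rw [e2 t h1]
      exact (hη t h1).congr e2 (e2 t h1)
    · apply HasFDerivWithinAt.of_notMem_closure
      rwa [isClosed_Icc.closure_eq]
  rw [hU]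
  exact d1.union d2

lemma aux_start {n : ℕ} (θs : EuclideanSpace ℝ (Fin n))
    (r : EuclideanSpace ℝ (Fin n) → EuclideanSpace ℝ (Fin 3))
    (hr : ContDiff ℝ 1 r)
    (b : EuclideanSpace ℝ (Fin 3)) (hb : b = r θs) (hb0 : b ≠ 0)
    (α : ℝ) (hα : α ∈ Set.Ioo 0 (π / 2))
    (C : EuclideanSpace ℝ (Fin n) → ℝ)
    (hC : ∀ θ, C θ = ‖r θ - b‖ ^ 2 * ‖b‖ ^ 2 * cos α ^ 2 - ⟪r θ - b, b⟫ ^ 2)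
    (w : EuclideanSpace ℝ (Fin n)) (hw0 : fderiv ℝ r θs w ≠ 0)
    (hwb : ⟪fderiv ℝ r θs w, b⟫ = 0) (δ : ℝ) (hδ : 0 < δ) :
    ∃ θ, ‖θ - θs‖ < δ ∧ 0 < C θ := by
  have hd : HasLineDerivAt ℝ r (fderiv ℝ r θs w) θs w :=
    ((hr.differentiable one_ne_zero) θs).hasFDerivAt.hasLineDerivAt w
  have hslope := hd.tendsto_slope_zero
  rw [← hb] at hslope
  let G : EuclideanSpace ℝ (Fin 3) → ℝ :=
    fun v => ‖v‖ ^ 2 * ‖b‖ ^ 2 * cos α ^ 2 - ⟪v, b⟫ ^ 2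
  have hG : Continuous G := by fun_prop
  have hcos : 0 < cos α := cos_pos_of_mem_Ioo ⟨by linarith [hα.1, pi_pos], hα.2⟩
  have hGpos : 0 < G (fderiv ℝ r θs w) := by
    have h1 := norm_pos_iff.mpr hw0
    have h2 := norm_pos_iff.mpr hb0
    simp only [G, hwb]
    have : 0 < ‖fderiv ℝ r θs w‖ ^ 2 * ‖b‖ ^ 2 * cos α ^ 2 := by positivity
    linarith
  have hev := ((hG.tendsto _).comp hslope).eventually (lt_mem_nhds hGpos)
  have hnear : ∀ᶠ t : ℝ in 𝓝[≠] 0, ‖(θs + t • w) - θs‖ < δ := by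
    apply eventually_nhdsWithin_of_eventually_nhds
    have hc : Continuous (fun t : ℝ => ‖(θs + t • w) - θs‖) := by fun_prop
    apply (hc.tendsto 0).eventually (gt_mem_nhds _)
    simpa using hδ
  obtain ⟨t, ⟨h1, h2⟩, h3⟩ := ((hev.and hnear).and self_mem_nhdsWithin).exists
  have ht : t ≠ 0 := h3
  refine ⟨θs + t • w, h2, ?_⟩
  have h4 : r (θs + t • w) - b = t • (t⁻¹ • (r (θs + t • w) - b)) := by
    rw [smul_smul, mul_inv_cancel₀ ht, one_smul]
  have h5 : C (θs + t • w) = t ^ 2 * G (t⁻¹ • (r (θs + t • w) - b)) := by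
    rw [hC]
    generalize t⁻¹ • (r (θs + t • w) - b) = v at h4 ⊢
    rw [h4]
    simp only [G, norm_smul, inner_smul_left, mul_pow, Real.norm_eq_abs, sq_abs]
    simp
    ring
  rw [h5]
  have h6 : 0 < G (t⁻¹ • (r (θs + t • w) - b)) := h1
  positivity

/-- Instability of the folded conformation `θ*` under optical tweezers, certified by the
Chetaev function `C_twz`: if the Chetaev derivative of `C` along `f` is positive on the
positivity set of `C` near `θ*`, then `θ*` is an unstable equilibrium of `θ̇ = f(θ)`. -/
theorem folded_conformation_unstable_under_tweezers {n : ℕ}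
    (f : EuclideanSpace ℝ (Fin n) → EuclideanSpace ℝ (Fin n))
    (θs : EuclideanSpace ℝ (Fin n))
    (hf : LocallyLipschitz f) (hfθs : f θs = 0)
    (r : EuclideanSpace ℝ (Fin n) → EuclideanSpace ℝ (Fin 3))
    (hr : ContDiff ℝ 1 r)
    (b : EuclideanSpace ℝ (Fin 3)) (hb : b = r θs) (hb0 : b ≠ 0)
    (α : ℝ) (hα : α ∈ Set.Ioo 0 (π / 2))
    (C : EuclideanSpace ℝ (Fin n) → ℝ)
    (hC : ∀ θ, C θ = ‖r θ - b‖ ^ 2 * ‖b‖ ^ 2 * cos α ^ 2 - ⟪r θ - b, b⟫ ^ 2)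
    (hw : ∃ w : EuclideanSpace ℝ (Fin n),
      fderiv ℝ r θs w ≠ 0 ∧ ⟪fderiv ℝ r θs w, b⟫ = 0)
    (hder : ∃ ρ > (0 : ℝ), ∀ θ ∈ Metric.closedBall θs ρ,
      0 < C θ → 0 < ⟪gradient C θ, f θ⟫) :
    ¬ LyapunovStable f θs := by
  intro hstab
  obtain ⟨w, hw0, hwb⟩ := hw
  obtain ⟨ρ, hρ, hpos⟩ := hder
  obtain ⟨δ, hδ, hst⟩ := hstab ρ hρ
  obtain ⟨θ0, hθ0, hC0⟩ := aux_start θs r hr b hb hb0 α hα C hC w hw0 hwb (min δ ρ) (lt_min hδ hρ)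
  have hCd : ContDiff ℝ 1 C := by
    have : C = fun θ => ‖r θ - b‖ ^ 2 * ‖b‖ ^ 2 * cos α ^ 2 - ⟪r θ - b, b⟫ ^ 2 := funext hC
    rw [this]
    have h1 : ContDiff ℝ 1 (fun θ => r θ - b) := hr.sub contDiff_const
    exact (((h1.norm_sq ℝ).mul contDiff_const).mul contDiff_const).sub
      ((h1.inner ℝ contDiff_const).pow 2)
  have hdiff : Differentiable ℝ C := hCd.differentiable one_ne_zero
  have hgrad : ∀ θ v, ⟪gradient C θ, v⟫ = fderiv ℝ C θ v := by
    intro θ v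
    rw [← toDual_gradient, InnerProductSpace.toDual_apply_apply]
  obtain ⟨τ, hτ, hext⟩ := aux_uniform f hf (Metric.closedBall θs ρ) (isCompact_closedBall _ _)
  -- solutions on arbitrarily long intervals
  have hsol : ∀ k : ℕ, ∃ γ : ℝ → EuclideanSpace ℝ (Fin n), γ 0 = θ0 ∧
      ∀ t ∈ Icc (0 : ℝ) (k * τ), HasDerivWithinAt γ (f (γ t)) (Icc 0 (k * τ)) t := by
    intro k
    induction k with
    | zero =>
      refine ⟨fun _ => θ0, rfl, fun t ht => ?_⟩
      have : t = 0 := by simpa using ht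
      subst this
      simp only [Nat.cast_zero, zero_mul, Icc_self]
      exact HasFDerivWithinAt.of_subsingleton Set.subsingleton_singleton
    | succ k ih =>
      obtain ⟨γ, h0, hγ⟩ := ih
      have hkτ : 0 ≤ (k : ℝ) * τ := by positivity
      have hmem : γ (k * τ) ∈ Metric.closedBall θs ρ := by
        rw [mem_closedBall_iff_norm]
        exact (hst γ (Icc 0 (k * τ)) ⟨⟨le_rfl, hkτ⟩, ordConnected_Icc, hγ⟩
          (by rw [h0]; exact hθ0.trans_le (min_le_left _ _)) _ ⟨hkτ, le_rfl⟩ hkτ).le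
      obtain ⟨η, hη0, hη⟩ := hext _ hmem (k * τ)
      obtain ⟨ζ, hζ0, hζ⟩ := aux_glue f (k * τ) τ hkτ hτ γ η hγ hη hη0
      refine ⟨ζ, hζ0.trans h0, ?_⟩
      have : ((k + 1 : ℕ) : ℝ) * τ = k * τ + τ := by push_cast; ring
      rw [this]
      exact hζ
  -- compactness
  have hcf : Continuous fun θ => fderiv ℝ C θ (f θ) :=
    (hCd.continuous_fderiv one_ne_zero).clm_apply hf.continuous
  have hK : IsCompact (Metric.closedBall θs ρ ∩ {θ | C θ0 ≤ C θ}) :=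
    (isCompact_closedBall _ _).inter_right (isClosed_le continuous_const hdiff.continuous)
  have hθ0K : θ0 ∈ Metric.closedBall θs ρ ∩ {θ | C θ0 ≤ C θ} := by
    refine ⟨?_, le_refl (C θ0)⟩
    rw [mem_closedBall_iff_norm]
    exact (hθ0.trans_le (min_le_right _ _)).le
  obtain ⟨θm, hθm, hmin⟩ := hK.exists_isMinOn ⟨θ0, hθ0K⟩ hcf.continuousOn
  set m := fderiv ℝ C θm (f θm) with hm
  have hm0 : 0 < m := by
    rw [hm, ← hgrad]
    exact hpos θm hθm.1 (hC0.trans_le hθm.2)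
  obtain ⟨M, hM⟩ := (isCompact_closedBall θs ρ).exists_bound_of_continuousOn
    hdiff.continuous.continuousOn
  obtain ⟨k, hk⟩ := exists_nat_gt (M / (m / 2 * τ))
  rw [div_lt_iff₀ (by positivity)] at hk
  obtain ⟨γ, h0, hγ⟩ := hsol k
  set T : ℝ := k * τ with hT
  have hT0 : 0 ≤ T := by positivity
  have hin : ∀ t ∈ Icc 0 T, γ t ∈ Metric.closedBall θs ρ := by
    intro t ht
    rw [mem_closedBall_iff_norm]
    exact (hst γ (Icc 0 T) ⟨⟨le_rfl, hT0⟩, ordConnected_Icc, hγ⟩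
      (by rw [h0]; exact hθ0.trans_le (min_le_left _ _)) _ ht ht.1).le
  have hCγ : ∀ t ∈ Icc 0 T,
      HasDerivWithinAt (fun s => - C (γ s)) (-(fderiv ℝ C (γ t) (f (γ t)))) (Icc 0 T) t := by
    intro t ht
    exact ((hdiff (γ t)).hasFDerivAt.comp_hasDerivWithinAt t (hγ t ht)).neg
  have hle := image_le_of_deriv_right_lt_deriv_boundary (f := fun s => - C (γ s))
    (f' := fun t => -(fderiv ℝ C (γ t) (f (γ t)))) (a := 0) (b := T)
    (B := fun t => - C θ0 - m / 2 * t) (B' := fun _ => - (m / 2))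
    (fun t ht => (hCγ t ht).continuousWithinAt)
    (fun t ht => (hCγ t ⟨ht.1, ht.2.le⟩).mono_of_mem_nhdsWithin
      (mem_of_superset (Icc_mem_nhdsGE ht.2) (Icc_subset_Icc ht.1 le_rfl)))
    (by simp [h0])
    (fun t => by
      simpa using ((hasDerivAt_id t).const_mul (m / 2)).const_sub (- C θ0))
    (by
      intro t ht heq
      have heq' : - C (γ t) = - C θ0 - m / 2 * t := heq
      have hge : C θ0 ≤ C (γ t) := by
        have : 0 ≤ m / 2 * t := mul_nonneg (by positivity) ht.1
        linarith
      have h1 : m ≤ fderiv ℝ C (γ t) (f (γ t)) := hmin ⟨hin t ⟨ht.1, ht.2.le⟩, hge⟩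
      change -(fderiv ℝ C (γ t) (f (γ t))) < -(m / 2)
      linarith)
  have hfin : - C (γ T) ≤ - C θ0 - m / 2 * T := hle ⟨hT0, le_rfl⟩
  have hb1 := hM _ (hin T ⟨hT0, le_rfl⟩)
  have hb2 := (le_abs_self _).trans hb1
  have : (k : ℝ) * (m / 2 * τ) = m / 2 * T := by rw [hT]; ring
  linarith
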